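/- For every integer k ≥ 0, the ratio 𝔉_k(t) = F_{k+1}(t)/F_k(t), where F_k(t) = (−1)^k · (d/dt)^k [1/(e^t − 1)], tends to +∞ as t → 0⁺ and tends to 1 as t → ∞. -/

import Mathlib

open Filter

/-- `F_k(t) = (−1)^k · (d/dt)^k [1/(e^t − 1)]`. -/
noncomputable def F (k : ℕ) (t : ℝ) : ℝ :=
  (-1) ^ k * iteratedDeriv k (fun s => 1 / (Real.exp s - 1)) t

open Polynomial in
/-- The polynomials with `F k t = u * (boseQuotient k).eval u`, where `u = 1 / (exp t - 1)`. -/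
noncomputable def boseQuotient : ℕ → Polynomial ℝ
  | 0 => 1
  | k + 1 => (1 + X) * derivative (X * boseQuotient k)

namespace boseQuotient

open Polynomial

theorem coeff_succ_succ (k n : ℕ) : (boseQuotient (k + 1)).coeff (n + 1) =
    (n + 2) * (boseQuotient k).coeff (n + 1) + (n + 1) * (boseQuotient k).coeff n := by
  rw [boseQuotient, add_mul, one_mul, coeff_add, coeff_X_mul, coeff_derivative, coeff_derivative,
    coeff_X_mul, coeff_X_mul]
  push_cast
  ring

theorem eval_zero (k : ℕ) : (boseQuotient k).eval 0 = 1 := by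
  induction k with
  | zero => simp [boseQuotient]
  | succ k ih => simp [boseQuotient, derivative_mul, ih]

theorem coeff_eq_zero (k : ℕ) : ∀ n, k < n → (boseQuotient k).coeff n = 0 := by
  induction k with
  | zero =>
    intro n hn
    simp [boseQuotient, coeff_one, hn.ne']
  | succ k ih =>
    intro n hn
    obtain ⟨m, rfl⟩ : ∃ m, n = m + 1 := ⟨n - 1, by omega⟩
    rw [coeff_succ_succ, ih _ (by omega), ih _ (by omega)]
    simp

theorem coeff_self_pos (k : ℕ) : 0 < (boseQuotient k).coeff k := by
  induction k with
  | zero => simp [boseQuotient]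
  | succ k ih =>
    rw [coeff_succ_succ, coeff_eq_zero k _ k.lt_succ_self]
    positivity

theorem natDegree_eq (k : ℕ) : (boseQuotient k).natDegree = k :=
  natDegree_eq_of_le_of_coeff_ne_zero (natDegree_le_iff_coeff_eq_zero.2 (coeff_eq_zero k))
    (coeff_self_pos k).ne'

theorem leadingCoeff_pos (k : ℕ) : 0 < (boseQuotient k).leadingCoeff := by
  rw [leadingCoeff, natDegree_eq]
  exact coeff_self_pos k

theorem ne_zero (k : ℕ) : boseQuotient k ≠ 0 :=
  leadingCoeff_ne_zero.1 (leadingCoeff_pos k).ne'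

theorem tendsto_div_atTop (k : ℕ) :
    Tendsto (fun u => (boseQuotient (k + 1)).eval u / (boseQuotient k).eval u) atTop atTop := by
  refine div_tendsto_atTop_of_degree_gt _ _ ?_ (ne_zero k) ?_
  · rw [degree_eq_natDegree (ne_zero _), degree_eq_natDegree (ne_zero _), natDegree_eq,
      natDegree_eq]
    exact_mod_cast k.lt_succ_self
  · exact (div_pos (leadingCoeff_pos _) (leadingCoeff_pos _)).le

theorem tendsto_div_nhds_zero (k : ℕ) :
    Tendsto (fun u => (boseQuotient (k + 1)).eval u / (boseQuotient k).eval u)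
      (nhds 0) (nhds 1) := by
  have h := ((boseQuotient (k + 1)).continuous.tendsto 0).div
    ((boseQuotient k).continuous.tendsto 0) (by simp [eval_zero])
  simpa [eval_zero, Pi.div_def] using h

end boseQuotient

theorem exp_sub_one_pos {t : ℝ} (ht : 0 < t) : 0 < Real.exp t - 1 :=
  sub_pos.2 (Real.one_lt_exp_iff.2 ht)

theorem hasDerivAt_one_div_exp_sub_one {t : ℝ} (ht : 0 < t) :
    HasDerivAt (fun s => 1 / (Real.exp s - 1))
      (-(1 / (Real.exp t - 1) * (1 + 1 / (Real.exp t - 1)))) t := by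
  have hne := (exp_sub_one_pos ht).ne'
  have h := ((Real.hasDerivAt_exp t).sub_const 1).inv hne
  simp only [one_div]
  refine h.congr_deriv ?_
  field_simp
  ring

theorem iteratedDeriv_one_div_exp_sub_one (k : ℕ) : ∀ t : ℝ, 0 < t →
    iteratedDeriv k (fun s => 1 / (Real.exp s - 1)) t =
      (-1) ^ k * (Polynomial.X * boseQuotient k).eval (1 / (Real.exp t - 1)) := by
  induction k with
  | zero =>
    intro t _
    simp [boseQuotient]
  | succ k ih =>
    intro t ht
    have heq : iteratedDeriv k (fun s => 1 / (Real.exp s - 1)) =ᶠ[nhds t] fun s =>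
        (-1) ^ k * (Polynomial.X * boseQuotient k).eval (1 / (Real.exp s - 1)) :=
      (eventually_gt_nhds ht).mono ih
    have h := (((Polynomial.X * boseQuotient k).hasDerivAt (1 / (Real.exp t - 1))).comp t
      (hasDerivAt_one_div_exp_sub_one ht)).const_mul ((-1 : ℝ) ^ k)
    rw [iteratedDeriv_succ, heq.deriv_eq]
    refine h.deriv.trans ?_
    rw [boseQuotient]
    simp only [Polynomial.eval_mul, Polynomial.eval_add, Polynomial.eval_X, Polynomial.eval_one]
    ring

theorem F_eq_eval {k : ℕ} {t : ℝ} (ht : 0 < t) :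
    F k t = 1 / (Real.exp t - 1) * (boseQuotient k).eval (1 / (Real.exp t - 1)) := by
  rw [F, iteratedDeriv_one_div_exp_sub_one k t ht, ← mul_assoc, ← mul_pow]
  simp

theorem F_succ_div_F {k : ℕ} {t : ℝ} (ht : 0 < t) :
    (boseQuotient (k + 1)).eval (1 / (Real.exp t - 1)) /
      (boseQuotient k).eval (1 / (Real.exp t - 1)) = F (k + 1) t / F k t := by
  rw [F_eq_eval ht, F_eq_eval ht,
    mul_div_mul_left _ _ (one_div_pos.2 (exp_sub_one_pos ht)).ne']

theorem tendsto_one_div_exp_sub_one_nhdsGT_zero :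
    Tendsto (fun t => 1 / (Real.exp t - 1)) (nhdsWithin 0 (Set.Ioi 0)) atTop := by
  simp only [one_div]
  refine tendsto_inv_nhdsGT_zero.comp (tendsto_nhdsWithin_iff.2 ⟨?_, ?_⟩)
  · have h : Continuous fun t : ℝ => Real.exp t - 1 := by fun_prop
    simpa using (h.tendsto 0).mono_left nhdsWithin_le_nhds
  · exact eventually_mem_nhdsWithin.mono fun t ht => exp_sub_one_pos ht

theorem tendsto_one_div_exp_sub_one_atTop :
    Tendsto (fun t => 1 / (Real.exp t - 1)) atTop (nhds 0) := by
  simp only [one_div]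
  exact tendsto_inv_atTop_zero.comp (tendsto_atTop_add_const_right _ (-1) Real.tendsto_exp_atTop)

/-- For every integer `k ≥ 0`, the ratio `𝔉_k(t) = F_{k+1}(t)/F_k(t)` tends to `+∞`
as `t → 0⁺` and tends to `1` as `t → ∞`. -/
theorem F_ratio_limits (k : ℕ) :
    Tendsto (fun t => F (k + 1) t / F k t) (nhdsWithin 0 (Set.Ioi 0)) atTop ∧
      Tendsto (fun t => F (k + 1) t / F k t) atTop (nhds 1) := by
  constructor
  · exact ((boseQuotient.tendsto_div_atTop k).comp
      tendsto_one_div_exp_sub_one_nhdsGT_zero).congr'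
      (eventually_mem_nhdsWithin.mono fun t ht => F_succ_div_F ht)
  · exact ((boseQuotient.tendsto_div_nhds_zero k).comp
      tendsto_one_div_exp_sub_one_atTop).congr'
      ((eventually_gt_atTop 0).mono fun t ht => F_succ_div_F ht)
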